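/- Let p₀ ∈ (0,1), μ ∈ ℝ, σ > 0, and let γ ≠ 0 satisfy g(γ) > p₀ if γ > 0 and g(γ) > 1 − p₀ if γ < 0, where g(γ) = 2Φ(−|γ|)·exp(γ²/2). Let f_{p₀} be the quantile-fixed GAL density with parameters (μ, σ, γ). Then ∫_{−∞}^{μ} f_{p₀}(y) dy = p₀; that is, the parameter μ is the p₀-th quantile of the quantile-fixed GAL distribution. -/

import Mathlib

open MeasureTheory Real Set

/-- Standard normal CDF. -/
noncomputable def Phi (x : ℝ) : ℝ :=
  ∫ t in Set.Iic x, (Real.sqrt (2 * Real.pi))⁻¹ * Real.exp (-t ^ 2 / 2)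

/-- The function g(γ) = 2Φ(−|γ|)exp(γ²/2). -/
noncomputable def gFun (γ : ℝ) : ℝ := 2 * Phi (-|γ|) * Real.exp (γ ^ 2 / 2)

/-- The quantile-fixed GAL density with quantile p₀ and parameters (μ, σ, γ). -/
noncomputable def galQPdf (p₀ μ σ γ y : ℝ) : ℝ :=
  let p := (if γ < 0 then 1 else 0) + (p₀ - (if γ < 0 then 1 else 0)) / gFun γ
  let pP := p - (if 0 < γ then 1 else 0)
  let pM := p - (if γ < 0 then 1 else 0)
  let ys := (y - μ) / σ
  (2 * p * (1 - p) / σ) *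
    ((Phi (-(ys * pP / |γ|) + pM / pP * |γ|) - Phi (pM / pP * |γ|)) *
        Real.exp (-(ys * pM) + γ ^ 2 / 2 * (pM / pP) ^ 2) *
        (if 0 < ys / γ then 1 else 0) +
      Phi (-|γ| + ys * pP / |γ| * (if 0 < ys / γ then 1 else 0)) *
        Real.exp (-(ys * pP) + γ ^ 2 / 2))


open Filter Topology

/-- Standard normal density. -/
noncomputable def stdNormalDensity (x : ℝ) : ℝ :=
  (Real.sqrt (2 * Real.pi))⁻¹ * Real.exp (-x ^ 2 / 2)

lemma stdNormalDensity_pos (x : ℝ) : 0 < stdNormalDensity x := by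
  unfold stdNormalDensity; positivity

lemma continuous_stdNormalDensity : Continuous stdNormalDensity := by
  unfold stdNormalDensity; fun_prop

lemma integrable_stdNormalDensity : Integrable stdNormalDensity := by
  refine Integrable.const_mul ?_ _
  convert integrable_exp_neg_mul_sq (b := 1 / 2) (by norm_num) using 3
  ring

lemma Phi_eq (x : ℝ) : Phi x = ∫ t in Iic x, stdNormalDensity t := rfl

lemma hasDerivAt_Phi (x : ℝ) : HasDerivAt Phi (stdNormalDensity x) x := by
  have h : Phi = fun y => Phi 0 + ∫ t in (0 : ℝ)..y, stdNormalDensity t := by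
    funext y
    rw [← intervalIntegral.integral_Iic_sub_Iic integrable_stdNormalDensity.integrableOn
      integrable_stdNormalDensity.integrableOn, ← Phi_eq, ← Phi_eq]
    ring
  rw [h]
  exact (intervalIntegral.integral_hasDerivAt_right
    (continuous_stdNormalDensity.intervalIntegrable _ _)
    (continuous_stdNormalDensity.stronglyMeasurableAtFilter _ _)
    continuous_stdNormalDensity.continuousAt).const_add _

lemma Phi_strictMono : StrictMono Phi :=
  strictMono_of_hasDerivAt_pos hasDerivAt_Phi stdNormalDensity_pos

lemma Phi_nonneg (x : ℝ) : 0 ≤ Phi x :=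
  integral_nonneg fun t => (stdNormalDensity_pos t).le

lemma Phi_pos (x : ℝ) : 0 < Phi x :=
  (Phi_nonneg (x - 1)).trans_lt (Phi_strictMono (sub_one_lt x))

lemma Phi_le_one (x : ℝ) : Phi x ≤ 1 := by
  have h : ∫ t, stdNormalDensity t = 1 := by
    have h2 : ∀ t, stdNormalDensity t = (√(2 * π))⁻¹ * exp (-(1 / 2) * t ^ 2) := fun t => by
      rw [stdNormalDensity]; ring_nf
    simp_rw [h2]
    rw [integral_const_mul, integral_gaussian, show π / (1 / 2) = 2 * π by ring]
    exact inv_mul_cancel₀ (by positivity)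
  rw [← h]
  exact setIntegral_le_integral integrable_stdNormalDensity
    (Eventually.of_forall fun t => (stdNormalDensity_pos t).le)

lemma Phi_zero : Phi 0 = 1 / 2 := by
  have h2 : ∀ t, stdNormalDensity t = (√(2 * π))⁻¹ * exp (-(1 / 2) * (-t) ^ 2) := fun t => by
    rw [stdNormalDensity]; ring_nf
  rw [Phi_eq]
  simp_rw [h2]
  rw [integral_const_mul, integral_comp_neg_Iic 0 (fun t => exp (-(1 / 2) * t ^ 2)), neg_zero,
    integral_gaussian_Ioi, show π / (1 / 2) = 2 * π by ring]
  have : √(2 * π) ≠ 0 := by positivity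
  field_simp

/-- The lower tail of the normal distribution decays faster than any exponential. -/
lemma Phi_le_exp_mul {m : ℝ} (hm : 0 < m) (x : ℝ) :
    Phi x ≤ (√(2 * π))⁻¹ * exp (m ^ 2 / 2) / m * exp (m * x) := by
  have hint := (integrableOn_exp_mul_Iic hm x).const_mul ((√(2 * π))⁻¹ * exp (m ^ 2 / 2))
  calc Phi x ≤ ∫ t in Iic x, (√(2 * π))⁻¹ * exp (m ^ 2 / 2) * exp (m * t) := by
        rw [Phi_eq]
        refine integral_mono integrable_stdNormalDensity.integrableOn hint fun t => ?_
        simp only [stdNormalDensity]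
        rw [mul_assoc, ← exp_add]
        gcongr
        nlinarith [sq_nonneg (t + m)]
    _ = _ := by
        rw [integral_const_mul, integral_exp_mul_Iic hm]
        ring

lemma tendsto_exp_mul_atBot {k : ℝ} (hk : 0 < k) :
    Tendsto (fun x : ℝ => exp (k * x)) atBot (𝓝 0) :=
  tendsto_exp_atBot.comp (tendsto_id.const_mul_atBot hk)

lemma tendsto_Phi_mul_exp_atBot {k : ℝ} (hk : 0 < k) (b l : ℝ) :
    Tendsto (fun x => Phi (b + k * x) * exp (l * x)) atBot (𝓝 0) := by
  set m := (|l| + 1) / k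
  have hm : 0 < m := by positivity
  have hmk : m * k = |l| + 1 := by simp only [m]; field_simp
  have hpos : 0 < |l| + 1 + l := by linarith [neg_abs_le l]
  refine squeeze_zero (g := fun x => (√(2 * π))⁻¹ * exp (m ^ 2 / 2) / m * exp (m * b) *
    exp ((|l| + 1 + l) * x)) (fun x => mul_nonneg (Phi_nonneg _) (exp_pos _).le) (fun x => ?_) ?_
  · refine (mul_le_mul_of_nonneg_right (Phi_le_exp_mul hm _) (exp_pos _).le).trans_eq ?_
    rw [mul_assoc, mul_assoc, ← exp_add, ← exp_add]
    congr 2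
    linear_combination x * hmk
  · simpa using (tendsto_exp_mul_atBot hpos).const_mul
      ((√(2 * π))⁻¹ * exp (m ^ 2 / 2) / m * exp (m * b))

lemma integral_Iic_of_hasDerivAt_of_nonneg {G h : ℝ → ℝ} {a l : ℝ}
    (hd : ∀ x ∈ Iic a, HasDerivAt G (h x) x) (hn : ∀ x ∈ Iio a, 0 ≤ h x)
    (hG : Tendsto G atBot (𝓝 l)) : ∫ x in Iic a, h x = G a - l := by
  have key := integral_Ioi_of_hasDerivAt_of_nonneg' (a := -a) (g := fun x => -G (-x))
    (g' := fun x => h (-x)) (l := -l)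
    (fun x hx => by
      have := (hd (-x) (by simpa using neg_le.mp hx)).comp x (hasDerivAt_neg x)
      exact this.neg.congr_deriv (by simp))
    (fun x hx => hn (-x) (by simpa using neg_lt.mp hx))
    (hG.comp tendsto_neg_atTop_atBot).neg
  rw [integral_comp_neg_Ioi, neg_neg] at key
  rw [key]
  ring

/-- Integration of a density on the left of its location parameter, given an antiderivative of
its standardized version. -/
lemma integral_Iic_of_hasDerivAt_standardized {f G h : ℝ → ℝ} {μ σ : ℝ} (hσ : 0 < σ)
    (hf : ∀ y, y < μ → f y = h ((y - μ) / σ) / σ) (hd : ∀ x, HasDerivAt G (h x) x)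
    (hn : ∀ x < 0, 0 ≤ h x) (hG : Tendsto G atBot (𝓝 0)) :
    ∫ y in Iic μ, f y = G 0 := by
  rw [integral_Iic_eq_integral_Iio, setIntegral_congr_fun measurableSet_Iio (fun y hy => hf y hy),
    ← integral_Iic_eq_integral_Iio, integral_Iic_of_hasDerivAt_of_nonneg
      (G := fun y => G ((y - μ) / σ)) (l := 0)]
  · simp
  · intro y _
    have := (hd ((y - μ) / σ)).comp y (((hasDerivAt_id y).sub_const μ).div_const σ)
    simpa [Function.comp_def, div_eq_mul_inv] using this
  · intro y hy
    exact div_nonneg (hn _ (div_neg_of_neg_of_pos (sub_neg.mpr hy) hσ)) hσ.le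
  · refine hG.comp (Tendsto.atBot_div_const hσ ?_)
    exact tendsto_atBot_add_const_right _ (-μ) tendsto_id

lemma gFun_pos (γ : ℝ) : 0 < gFun γ := by
  have := Phi_pos (-|γ|)
  unfold gFun; positivity

lemma galQ_quantile_of_pos {p₀ μ σ γ : ℝ} (hp₀ : p₀ ∈ Set.Ioo (0 : ℝ) 1) (hσ : 0 < σ)
    (hγ : 0 < γ) (hg : p₀ < gFun γ) :
    ∫ y in Iic μ, galQPdf p₀ μ σ γ y = p₀ := by
  have hgp := gFun_pos γ
  set p := p₀ / gFun γ with hp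
  have hp0 : 0 < p := div_pos hp₀.1 hgp
  have hp1 : p < 1 := (div_lt_one hgp).2 hg
  have hpg : p * gFun γ = p₀ := div_mul_cancel₀ _ hgp.ne'
  have hlim : Tendsto (fun x => 2 * p * (Phi (-|γ|) * exp (-(x * (p - 1)) + γ ^ 2 / 2))) atBot
      (𝓝 0) := by
    have := (tendsto_exp_mul_atBot (sub_pos.2 hp1)).const_mul
      (2 * p * Phi (-|γ|) * exp (γ ^ 2 / 2))
    rw [mul_zero] at this
    refine this.congr fun x => ?_
    rw [exp_add]
    ring_nf
  rw [integral_Iic_of_hasDerivAt_standardized hσ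
    (h := fun x => 2 * p * (1 - p) * (Phi (-|γ|) * exp (-(x * (p - 1)) + γ ^ 2 / 2)))
    (G := fun x => 2 * p * (Phi (-|γ|) * exp (-(x * (p - 1)) + γ ^ 2 / 2))) _ _ _ hlim]
  · rw [← hpg, gFun]
    simp
    ring
  · intro y hy
    have h1 : ¬ 0 < (y - μ) / σ / γ := not_lt.2 <|
      (div_neg_of_neg_of_pos (div_neg_of_neg_of_pos (sub_neg.2 hy) hσ) hγ).le
    simp only [galQPdf, if_neg hγ.not_gt, if_pos hγ, if_neg h1, zero_add, sub_zero, ← hp,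
      mul_zero, add_zero]
    ring
  · intro x
    have := (((((hasDerivAt_id x).mul_const (p - 1)).neg).add_const (γ ^ 2 / 2)).exp.const_mul
      (Phi (-|γ|))).const_mul (2 * p)
    refine this.congr_deriv ?_
    simp only [id, Pi.neg_apply]
    ring
  · intro x _
    have := Phi_nonneg (-|γ|)
    have := sub_pos.2 hp1
    positivity

/-- Antiderivative of the standardized quantile-fixed GAL density on the negative half-line, in the
case of a negative shape parameter. -/
noncomputable def galAntideriv (p a x : ℝ) : ℝ :=
  2 * p * ((Phi (-(x * p / a) + (p - 1) / p * a) - Phi ((p - 1) / p * a)) *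
    exp (-(x * (p - 1)) + a ^ 2 / 2 * ((p - 1) / p) ^ 2) + Phi (x * p / a)) +
  2 * (1 - p) * (Phi (x * p / a) - Phi (-a + x * p / a) * exp (-(x * p) + a ^ 2 / 2))

lemma hasDerivAt_galAntideriv {p a : ℝ} (hp : 0 < p) (ha : 0 < a) (x : ℝ) :
    HasDerivAt (galAntideriv p a)
      (2 * p * (1 - p) *
        ((Phi (-(x * p / a) + (p - 1) / p * a) - Phi ((p - 1) / p * a)) *
          exp (-(x * (p - 1)) + a ^ 2 / 2 * ((p - 1) / p) ^ 2) +
        Phi (-a + x * p / a) * exp (-(x * p) + a ^ 2 / 2))) x := by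
  have hl : HasDerivAt (fun x : ℝ => x * p / a) (p / a) x := by
    simpa using ((hasDerivAt_id x).mul_const p).div_const a
  have hE1 : HasDerivAt (fun x : ℝ => exp (-(x * (p - 1)) + a ^ 2 / 2 * ((p - 1) / p) ^ 2)) _ x :=
    ((((hasDerivAt_id x).mul_const (p - 1)).neg).add_const _).exp
  have hE2 : HasDerivAt (fun x : ℝ => exp (-(x * p) + a ^ 2 / 2)) _ x :=
    ((((hasDerivAt_id x).mul_const p).neg).add_const _).exp
  have hP1 : HasDerivAt (fun x => Phi (-(x * p / a) + (p - 1) / p * a)) _ x :=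
    (hasDerivAt_Phi _).comp x (hl.neg.add_const ((p - 1) / p * a))
  have hP2 : HasDerivAt (fun x => Phi (-a + x * p / a)) _ x :=
    (hasDerivAt_Phi _).comp x (hl.const_add (-a))
  have hP3 : HasDerivAt (fun x => Phi (x * p / a)) _ x := (hasDerivAt_Phi _).comp x hl
  have e1 : stdNormalDensity (-(x * p / a) + (p - 1) / p * a) *
      exp (-(x * (p - 1)) + a ^ 2 / 2 * ((p - 1) / p) ^ 2) = stdNormalDensity (x * p / a) := by
    rw [stdNormalDensity, stdNormalDensity, mul_assoc, ← exp_add]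
    congr 2
    field_simp
    ring
  have e2 : stdNormalDensity (-a + x * p / a) * exp (-(x * p) + a ^ 2 / 2) =
      stdNormalDensity (x * p / a) := by
    rw [stdNormalDensity, stdNormalDensity, mul_assoc, ← exp_add]
    congr 2
    field_simp
    ring
  have := ((((hP1.sub_const (Phi ((p - 1) / p * a))).mul hE1).add hP3).const_mul (2 * p)).add
    ((hP3.sub (hP2.mul hE2)).const_mul (2 * (1 - p)))
  refine this.congr_deriv ?_
  simp only [id, Pi.neg_apply]
  linear_combination (-2 * p * (p / a)) * e1 - (2 * (1 - p) * (p / a)) * e2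

lemma tendsto_galAntideriv {p a : ℝ} (hp0 : 0 < p) (hp1 : p < 1) (ha : 0 < a) :
    Tendsto (galAntideriv p a) atBot (𝓝 0) := by
  have hk : 0 < p / a := by positivity
  have h1 : Tendsto (fun x => (Phi (-(x * p / a) + (p - 1) / p * a) - Phi ((p - 1) / p * a)) *
      exp (-(x * (p - 1)) + a ^ 2 / 2 * ((p - 1) / p) ^ 2)) atBot (𝓝 0) := by
    refine squeeze_zero_norm (a := fun x => exp (a ^ 2 / 2 * ((p - 1) / p) ^ 2) *
      exp ((1 - p) * x)) (fun x => ?_) ?_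
    · rw [norm_mul, ← exp_add, Real.norm_eq_abs, Real.norm_eq_abs, abs_exp]
      have hle : |Phi (-(x * p / a) + (p - 1) / p * a) - Phi ((p - 1) / p * a)| ≤ 1 := by
        rw [abs_le]
        constructor <;> linarith [Phi_nonneg (-(x * p / a) + (p - 1) / p * a),
          Phi_nonneg ((p - 1) / p * a), Phi_le_one (-(x * p / a) + (p - 1) / p * a),
          Phi_le_one ((p - 1) / p * a)]
      refine (mul_le_of_le_one_left (exp_pos _).le hle).trans_eq ?_
      ring_nf
    · simpa using (tendsto_exp_mul_atBot (sub_pos.2 hp1)).const_mul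
        (exp (a ^ 2 / 2 * ((p - 1) / p) ^ 2))
  have h2 : Tendsto (fun x => Phi (x * p / a)) atBot (𝓝 0) := by
    refine (tendsto_Phi_mul_exp_atBot hk 0 0).congr fun x => ?_
    simp only [zero_mul, exp_zero, mul_one, zero_add]
    ring_nf
  have h3 : Tendsto (fun x => Phi (-a + x * p / a) * exp (-(x * p) + a ^ 2 / 2)) atBot (𝓝 0) := by
    have := (tendsto_Phi_mul_exp_atBot hk (-a) (-p)).mul_const (exp (a ^ 2 / 2))
    rw [zero_mul] at this
    refine this.congr fun x => ?_
    rw [mul_assoc, ← exp_add]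
    ring_nf
  simpa [galAntideriv] using!
    ((h1.add h2).const_mul (2 * p)).add ((h2.sub h3).const_mul (2 * (1 - p)))

lemma galQ_quantile_of_neg {p₀ μ σ γ : ℝ} (hp₀ : p₀ ∈ Set.Ioo (0 : ℝ) 1) (hσ : 0 < σ)
    (hγ : γ < 0) (hg : 1 - p₀ < gFun γ) :
    ∫ y in Iic μ, galQPdf p₀ μ σ γ y = p₀ := by
  have hgp := gFun_pos γ
  set p := 1 + (p₀ - 1) / gFun γ with hp
  have hpg : (1 - p) * gFun γ = 1 - p₀ := by rw [hp]; field_simp; ring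
  have hp1 : p < 1 := by
    have : (p₀ - 1) / gFun γ < 0 := div_neg_of_neg_of_pos (by linarith [hp₀.2]) hgp
    linarith
  have hp0 : 0 < p := by
    by_contra! h
    nlinarith
  have ha : 0 < |γ| := abs_pos.2 hγ.ne
  rw [integral_Iic_of_hasDerivAt_standardized hσ _ (hasDerivAt_galAntideriv hp0 ha) _
    (tendsto_galAntideriv hp0 hp1 ha)]
  · simp only [galAntideriv, zero_mul, zero_div, neg_zero, zero_add, sub_self, add_zero, Phi_zero,
      sq_abs]
    rw [gFun] at hpg
    linear_combination -hpg
  · intro y hy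
    have h1 : 0 < (y - μ) / σ / γ :=
      div_pos_of_neg_of_neg (div_neg_of_neg_of_pos (sub_neg.2 hy) hσ) hγ
    simp only [galQPdf, if_neg hγ.not_gt, if_pos hγ, if_pos h1, sub_zero, ← hp, mul_one, sq_abs]
    ring
  · intro x hx
    have h1 : 0 ≤ Phi (-(x * p / |γ|) + (p - 1) / p * |γ|) - Phi ((p - 1) / p * |γ|) := by
      refine sub_nonneg.2 (Phi_strictMono.monotone ?_)
      have : x * p / |γ| < 0 := div_neg_of_neg_of_pos (mul_neg_of_neg_of_pos hx hp0) ha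
      linarith
    have h2 := Phi_nonneg (-|γ| + x * p / |γ|)
    have h3 := sub_pos.2 hp1
    positivity

/-- μ is the p₀-th quantile of the quantile-fixed GAL distribution. -/
theorem galQ_quantile (p₀ μ σ γ : ℝ) (hp₀ : p₀ ∈ Set.Ioo (0 : ℝ) 1) (hσ : 0 < σ)
    (hγ : γ ≠ 0) (hγp : 0 < γ → p₀ < gFun γ) (hγn : γ < 0 → 1 - p₀ < gFun γ) :
    (∫ y in Set.Iic μ, galQPdf p₀ μ σ γ y) = p₀ := by
  rcases hγ.lt_or_gt with h | h
  · exact galQ_quantile_of_neg hp₀ hσ h (hγn h)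
  · exact galQ_quantile_of_pos hp₀ hσ h (hγp h)
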